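/- arXiv:2603.06815 — 5 statements merged into one kernel-verified Lean document; each statement's English description precedes it below -/
import Mathlib

section
/- Let D ⊆ ℝ^d × ℝ be open, let S : D → ℝ be twice continuously differentiable, and let K : D → (0,∞) be continuous. For ε ∈ (0, ε_0) let K^ε : D → (0,∞) be functions with K^ε → K uniformly on D as ε → 0, and set p^ε(x,t) := K^ε(x,t) · exp(−ε^{−1} S(x,t)). Then for every compact set Γ ⊆ D and every compact set F ⊆ ℝ^d, sup over (x,t) ∈ Γ and z ∈ F of | p^ε(x + εz, t − ε) / p^ε(x,t) − exp(−⟨z, ∇_x S(x,t)⟩ + ∂_t S(x,t)) | tends to 0 as ε → 0 (the shifted points (x + εz, t − ε) lie in D for all sufficiently small ε). -/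
open MeasureTheory

open Filter Topology Asymptotics in
theorem local_ratio_tendsto {E : Type*} [NormedAddCommGroup E] [NormedSpace ℝ E]
    (D : Set E) (hD : IsOpen D) (S : E → ℝ) (hS : ContDiffOn ℝ 2 S D)
    (K : E → ℝ) (hKcont : ContinuousOn K D) (hKpos : ∀ p ∈ D, 0 < K p)
    (Kε : ℝ → E → ℝ) (hKεunif : TendstoUniformlyOn Kε K (𝓝[>] 0) D)
    (p₀ v₀ : E) (hp₀ : p₀ ∈ D) (L : Filter (ℝ × (E × E)))
    (hL : L = 𝓝[>] 0 ×ˢ 𝓝 (p₀, v₀)) :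
    (∀ᶠ w in L, w.2.1 + w.1 • w.2.2 ∈ D) ∧
    Tendsto (fun w : ℝ × (E × E) =>
      (Kε w.1 (w.2.1 + w.1 • w.2.2) * Real.exp (-(w.1⁻¹ * S (w.2.1 + w.1 • w.2.2)))) /
        (Kε w.1 w.2.1 * Real.exp (-(w.1⁻¹ * S w.2.1)))
        - Real.exp (-(fderiv ℝ S w.2.1 w.2.2))) L (𝓝 0) := by
  have hε : Tendsto (fun w : ℝ × (E × E) => w.1) L (𝓝[>] 0) := hL ▸ tendsto_fst
  have hε0 : Tendsto (fun w : ℝ × (E × E) => w.1) L (𝓝 0) := hε.mono_right nhdsWithin_le_nhds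
  have h2 : Tendsto (fun w : ℝ × (E × E) => w.2) L (𝓝 (p₀, v₀)) := hL ▸ tendsto_snd
  have hp : Tendsto (fun w : ℝ × (E × E) => w.2.1) L (𝓝 p₀) :=
    (continuous_fst.tendsto (p₀, v₀)).comp h2
  have hv : Tendsto (fun w : ℝ × (E × E) => w.2.2) L (𝓝 v₀) :=
    (continuous_snd.tendsto (p₀, v₀)).comp h2
  have ha : Tendsto (fun w : ℝ × (E × E) => w.2.1 + w.1 • w.2.2) L (𝓝 p₀) := by
    simpa using hp.add (hε0.smul hv)
  have hDn : D ∈ 𝓝 p₀ := hD.mem_nhds hp₀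
  have hpos : ∀ᶠ w in L, 0 < w.1 := hε.eventually self_mem_nhdsWithin
  have hcd : ContDiffAt ℝ 2 S p₀ := hS.contDiffAt hDn
  have hK : ∀ g : ℝ × (E × E) → E, Tendsto g L (𝓝 p₀) →
      Tendsto (fun w => Kε w.1 (g w)) L (𝓝 (K p₀)) := by
    intro g hg
    refine tendsto_comp_of_locally_uniform_limit_within (F := fun w : ℝ × (E × E) => Kε w.1)
      (hKcont p₀ hp₀) (s := D) ?_ ?_
    · rwa [hD.nhdsWithin_eq hp₀]
    · intro u hu
      exact ⟨D, self_mem_nhdsWithin, hε.eventually (hKεunif u hu)⟩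
  have hKr : Tendsto (fun w : ℝ × (E × E) => Kε w.1 (w.2.1 + w.1 • w.2.2) / Kε w.1 w.2.1)
      L (𝓝 1) := by
    have := (hK _ ha).div (hK _ hp) (hKpos _ hp₀).ne'
    rwa [div_self (hKpos _ hp₀).ne'] at this
  have hf : Tendsto (fun w : ℝ × (E × E) => fderiv ℝ S w.2.1 w.2.2) L
      (𝓝 (fderiv ℝ S p₀ v₀)) := by
    have hc : ContinuousAt (fderiv ℝ S) p₀ :=
      (hcd.fderiv_right (m := 1) (by norm_num)).continuousAt
    have h := (isBoundedBilinearMap_apply (𝕜 := ℝ) (E := E) (F := ℝ)).continuous.tendsto (fderiv ℝ S p₀, v₀)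
    exact h.comp ((hc.tendsto.comp hp).prodMk_nhds hv)
  have hstr : HasStrictFDerivAt S (fderiv ℝ S p₀) p₀ := hcd.hasStrictFDerivAt (by norm_num)
  have ho := hstr.isLittleO.comp_tendsto (ha.prodMk_nhds hp)
  have ho2 : (fun w : ℝ × (E × E) => S (w.2.1 + w.1 • w.2.2) - S w.2.1
      - w.1 * fderiv ℝ S p₀ w.2.2) =o[L] (fun w => w.1) := by
    have hb : (fun w : ℝ × (E × E) => w.1 • w.2.2) =O[L] (fun w => w.1) := by
      have := (isBigO_refl (fun w : ℝ × (E × E) => w.1) L).smul (hv.isBigO_one ℝ)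
      simpa using this
    refine IsLittleO.trans_isBigO ?_ hb
    simpa [Function.comp_def] using ho
  have hq : Tendsto (fun w : ℝ × (E × E) => w.1⁻¹ * (S (w.2.1 + w.1 • w.2.2) - S w.2.1)) L
      (𝓝 (fderiv ℝ S p₀ v₀)) := by
    have h1 := ho2.tendsto_div_nhds_zero.add
      (((fderiv ℝ S p₀).continuous.tendsto v₀).comp hv)
    rw [zero_add] at h1
    refine h1.congr' ?_
    filter_upwards [hpos] with w hw
    simp only [Function.comp]
    field_simp
    ring
  refine ⟨ha.eventually hDn, ?_⟩
  have hfin := (hKr.mul ((Real.continuous_exp.tendsto _).comp hq.neg)).sub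
    ((Real.continuous_exp.tendsto _).comp hf.neg)
  rw [one_mul, sub_self] at hfin
  refine hfin.congr fun w => ?_
  simp only [Function.comp]
  rw [mul_div_mul_comm, ← Real.exp_sub]
  congr 4
  ring

/-- **backward prefactor lemma.** Let `D ⊆ ℝ^d × ℝ` be open, `S : D → ℝ`
be `C²`, `K : D → (0,∞)` continuous, and for `ε ∈ (0, ε₀)` let `K^ε : D → (0,∞)` converge
uniformly on `D` to `K` as `ε → 0`. Set `p^ε(x,t) = K^ε(x,t)·exp(-ε⁻¹ S(x,t))`. Then for
all compact `Γ ⊆ D` and compact `F ⊆ ℝ^d`, uniformly over `(x,t) ∈ Γ` and `z ∈ F`,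
`p^ε(x+εz, t-ε)/p^ε(x,t) → exp(-⟪z, ∇ₓS(x,t)⟫ + ∂ₜS(x,t))` as `ε → 0`, the shifted
points `(x+εz, t-ε)` lying in `D` for all sufficiently small `ε`. -/
theorem prefactor_ratio_backward (d : ℕ)
    (D : Set (EuclideanSpace ℝ (Fin d) × ℝ)) (hD : IsOpen D)
    (S : EuclideanSpace ℝ (Fin d) × ℝ → ℝ) (hS : ContDiffOn ℝ 2 S D)
    (K : EuclideanSpace ℝ (Fin d) × ℝ → ℝ)
    (hKcont : ContinuousOn K D) (hKpos : ∀ p ∈ D, 0 < K p)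
    (ε₀ : ℝ) (hε₀ : 0 < ε₀)
    (Kε : ℝ → EuclideanSpace ℝ (Fin d) × ℝ → ℝ)
    (hKεpos : ∀ ε ∈ Set.Ioo 0 ε₀, ∀ p ∈ D, 0 < Kε ε p)
    (hKεunif : TendstoUniformlyOn Kε K (nhdsWithin 0 (Set.Ioi 0)) D)
    (pe : ℝ → EuclideanSpace ℝ (Fin d) × ℝ → ℝ)
    (hpe : ∀ ε p, pe ε p = Kε ε p * Real.exp (-(ε⁻¹ * S p))) :
    ∀ Γ : Set (EuclideanSpace ℝ (Fin d) × ℝ), IsCompact Γ → Γ ⊆ D →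
    ∀ F : Set (EuclideanSpace ℝ (Fin d)), IsCompact F →
    ∀ η > (0 : ℝ), ∃ ε₁ > (0 : ℝ), ε₁ ≤ ε₀ ∧
      ∀ ε : ℝ, 0 < ε → ε < ε₁ →
      ∀ x : EuclideanSpace ℝ (Fin d), ∀ t : ℝ, (x, t) ∈ Γ → ∀ z ∈ F,
        (x + ε • z, t - ε) ∈ D ∧
        |pe ε (x + ε • z, t - ε) / pe ε (x, t) -
          Real.exp (-(fderiv ℝ S (x, t) (z, 0)) + fderiv ℝ S (x, t) (0, 1))| < η := by
  intro Γ hΓ hΓD F hF η hη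
  have hG : IsCompact ((fun z : EuclideanSpace ℝ (Fin d) => (z, (-1 : ℝ))) '' F) :=
    hF.image (by fun_prop)
  have key := (hΓ.prod hG).eventually_forall_of_forall_eventually (x₀ := (0 : ℝ))
    (P := fun ε q => 0 < ε → q.1 + ε • q.2 ∈ D ∧
      |pe ε (q.1 + ε • q.2) / pe ε q.1 - Real.exp (-(fderiv ℝ S q.1 q.2))| < η) (by
    rintro ⟨p₀, v₀⟩ ⟨hp₀, -⟩
    obtain ⟨h1, h2⟩ := local_ratio_tendsto D hD S hS K hKcont hKpos Kε hKεunif p₀ v₀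
      (hΓD hp₀) _ rfl
    have h3 := h1.and (h2.eventually (Metric.ball_mem_nhds 0 hη))
    have hle : nhdsWithin (0 : ℝ) (Set.Ioi 0) ×ˢ nhds (p₀, v₀) =
        nhdsWithin ((0 : ℝ), (p₀, v₀)) (Set.Ioi 0 ×ˢ Set.univ) := by
      rw [nhdsWithin_prod_eq, nhdsWithin_univ]
    rw [hle, eventually_nhdsWithin_iff] at h3
    filter_upwards [h3] with w hw hpos
    obtain ⟨h4, h5⟩ := hw ⟨hpos, Set.mem_univ _⟩
    refine ⟨h4, ?_⟩
    simp only [hpe]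
    simpa [Real.dist_eq] using h5)
  obtain ⟨δ, hδ, hball⟩ := Metric.eventually_nhds_iff.1 key
  refine ⟨min δ ε₀, lt_min hδ hε₀, min_le_right _ _, ?_⟩
  intro ε hε hεlt x t hxt z hz
  have h := hball (y := ε) (by
    rw [Real.dist_eq, sub_zero, abs_of_pos hε]
    exact hεlt.trans_le (min_le_left _ _)) ((x, t), (z, -1)) ⟨hxt, z, hz, rfl⟩ hε
  have e1 : (x, t) + ε • (z, (-1 : ℝ)) = (x + ε • z, t - ε) := by
    ext <;> simp [sub_eq_add_neg]
  have e2 : -(fderiv ℝ S (x, t) (z, 0)) + fderiv ℝ S (x, t) (0, 1)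
      = -(fderiv ℝ S (x, t) (z, -1)) := by
    have : (z, (-1 : ℝ)) = (z, 0) - (0, 1) := by simp
    rw [this, map_sub]
    ring
  rw [e2, ← e1]
  exact h
end

section
/- Let D ⊆ ℝ^d × ℝ be open, let S : D → ℝ be twice continuously differentiable, and let K : D → (0,∞) be continuous. For ε ∈ (0, ε_0) let K^ε : D → (0,∞) be functions with K^ε → K uniformly on D as ε → 0, and set p^ε(x,t) := K^ε(x,t) · exp(−ε^{−1} S(x,t)). Then for every compact set Γ ⊆ D and every compact set F ⊆ ℝ^d, sup over (x,t) ∈ Γ and z ∈ F of | p^ε(x + εz, t + ε) / p^ε(x,t) − exp(−⟨z, ∇_x S(x,t)⟩ − ∂_t S(x,t)) | tends to 0 as ε → 0 (the shifted points (x + εz, t + ε) lie in D for all sufficiently small ε). -/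
open MeasureTheory

/-- **forward prefactor lemma.** Let `D ⊆ ℝ^d × ℝ` be open, `S : D → ℝ`
be `C²`, `K : D → (0,∞)` continuous, and for `ε ∈ (0, ε₀)` let `K^ε : D → (0,∞)` converge
uniformly on `D` to `K` as `ε → 0`. Set `p^ε(x,t) = K^ε(x,t)·exp(-ε⁻¹ S(x,t))`. Then for
all compact `Γ ⊆ D` and compact `F ⊆ ℝ^d`, uniformly over `(x,t) ∈ Γ` and `z ∈ F`,
`p^ε(x+εz, t+ε)/p^ε(x,t) → exp(-⟪z, ∇ₓS(x,t)⟫ - ∂ₜS(x,t))` as `ε → 0`, the shifted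
points `(x+εz, t+ε)` lying in `D` for all sufficiently small `ε`. -/
theorem prefactor_ratio_forward (d : ℕ)
    (D : Set (EuclideanSpace ℝ (Fin d) × ℝ)) (hD : IsOpen D)
    (S : EuclideanSpace ℝ (Fin d) × ℝ → ℝ) (hS : ContDiffOn ℝ 2 S D)
    (K : EuclideanSpace ℝ (Fin d) × ℝ → ℝ)
    (hKcont : ContinuousOn K D) (hKpos : ∀ p ∈ D, 0 < K p)
    (ε₀ : ℝ) (hε₀ : 0 < ε₀)
    (Kε : ℝ → EuclideanSpace ℝ (Fin d) × ℝ → ℝ)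
    (hKεpos : ∀ ε ∈ Set.Ioo 0 ε₀, ∀ p ∈ D, 0 < Kε ε p)
    (hKεunif : TendstoUniformlyOn Kε K (nhdsWithin 0 (Set.Ioi 0)) D)
    (pe : ℝ → EuclideanSpace ℝ (Fin d) × ℝ → ℝ)
    (hpe : ∀ ε p, pe ε p = Kε ε p * Real.exp (-(ε⁻¹ * S p))) :
    ∀ Γ : Set (EuclideanSpace ℝ (Fin d) × ℝ), IsCompact Γ → Γ ⊆ D →
    ∀ F : Set (EuclideanSpace ℝ (Fin d)), IsCompact F →
    ∀ η > (0 : ℝ), ∃ ε₁ > (0 : ℝ), ε₁ ≤ ε₀ ∧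
      ∀ ε : ℝ, 0 < ε → ε < ε₁ →
      ∀ x : EuclideanSpace ℝ (Fin d), ∀ t : ℝ, (x, t) ∈ Γ → ∀ z ∈ F,
        (x + ε • z, t + ε) ∈ D ∧
        |pe ε (x + ε • z, t + ε) / pe ε (x, t) -
          Real.exp (-(fderiv ℝ S (x, t) (z, 0)) - fderiv ℝ S (x, t) (0, 1))| < η := by
  intro Γ hΓ hΓD F hF η hη
  have key : ∀ y ∈ Γ ×ˢ F, ∀ᶠ w : ℝ × ((EuclideanSpace ℝ (Fin d) × ℝ) × EuclideanSpace ℝ (Fin d))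
      in nhds ((0 : ℝ), y), (0 < w.1 → (w.2.1 + w.1 • (w.2.2, (1:ℝ)) ∈ D ∧
        |pe w.1 (w.2.1 + w.1 • (w.2.2, (1:ℝ))) / pe w.1 w.2.1 -
          Real.exp (-(fderiv ℝ S w.2.1 (w.2.2, 1)))| < η)) := by
    rintro ⟨p0, z0⟩ ⟨hp0, -⟩
    have hp0 : p0 ∈ D := hΓD hp0
    have hDn : D ∈ nhds p0 := hD.mem_nhds hp0
    suffices h : ∀ᶠ w : ℝ × ((EuclideanSpace ℝ (Fin d) × ℝ) × EuclideanSpace ℝ (Fin d))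
      in nhdsWithin ((0 : ℝ), (p0, z0)) (Prod.fst ⁻¹' Set.Ioi 0),
        (w.2.1 + w.1 • (w.2.2, (1:ℝ)) ∈ D ∧
        |pe w.1 (w.2.1 + w.1 • (w.2.2, (1:ℝ))) / pe w.1 w.2.1 -
          Real.exp (-(fderiv ℝ S w.2.1 (w.2.2, 1)))| < η) from
      eventually_nhdsWithin_iff.1 h
    set L := nhdsWithin ((0 : ℝ), (p0, z0)) (Prod.fst ⁻¹' Set.Ioi 0) with hL
    have hLle : L ≤ nhds ((0 : ℝ), (p0, z0)) := nhdsWithin_le_nhds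
    have hpos : ∀ᶠ w in L, 0 < w.1 := self_mem_nhdsWithin
    have he0 : Filter.Tendsto (fun w : ℝ × ((EuclideanSpace ℝ (Fin d) × ℝ) × EuclideanSpace ℝ (Fin d)) => w.1) L (nhds 0) :=
      (continuous_fst.tendsto _).mono_left hLle
    have he : Filter.Tendsto (fun w : ℝ × ((EuclideanSpace ℝ (Fin d) × ℝ) × EuclideanSpace ℝ (Fin d)) => w.1) L (nhdsWithin 0 (Set.Ioi 0)) :=
      tendsto_nhdsWithin_iff.2 ⟨he0, hpos⟩
    have hp : Filter.Tendsto (fun w : ℝ × ((EuclideanSpace ℝ (Fin d) × ℝ) × EuclideanSpace ℝ (Fin d)) => w.2.1) L (nhds p0) :=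
      ((continuous_fst.comp continuous_snd).tendsto _).mono_left hLle
    have hz : Filter.Tendsto (fun w : ℝ × ((EuclideanSpace ℝ (Fin d) × ℝ) × EuclideanSpace ℝ (Fin d)) => (w.2.2, (1:ℝ))) L (nhds (z0, 1)) :=
      (((continuous_snd.comp continuous_snd).prodMk continuous_const).tendsto _).mono_left hLle
    have hq : Filter.Tendsto (fun w : ℝ × ((EuclideanSpace ℝ (Fin d) × ℝ) × EuclideanSpace ℝ (Fin d)) => w.2.1 + w.1 • (w.2.2, (1:ℝ))) L (nhds p0) := by
      simpa using hp.add (he0.smul hz)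
    have hK : ∀ g : ℝ × ((EuclideanSpace ℝ (Fin d) × ℝ) × EuclideanSpace ℝ (Fin d)) → EuclideanSpace ℝ (Fin d) × ℝ,
        Filter.Tendsto g L (nhds p0) → Filter.Tendsto (fun w => Kε w.1 (g w)) L (nhds (K p0)) := by
      intro g hg
      have h1 : Filter.Tendsto (fun w => K (g w)) L (nhds (K p0)) :=
        (hKcont.continuousAt hDn).tendsto.comp hg
      refine h1.congr_uniformity ?_
      exact (tendstoUniformlyOn_iff_tendsto.1 hKεunif).comp
        (he.prodMk (Filter.tendsto_principal.2 (hg.eventually hDn)))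
    have hSp : ContDiffAt ℝ 2 S p0 := hS.contDiffAt hDn
    have hst : HasStrictFDerivAt S (fderiv ℝ S p0) p0 := hSp.hasStrictFDerivAt (by norm_num)
    have hfd : ContinuousAt (fderiv ℝ S) p0 :=
      (hSp.fderiv_right (m := 1) (by norm_num)).continuousAt
    have hlim : Filter.Tendsto (fun w : ℝ × ((EuclideanSpace ℝ (Fin d) × ℝ) × EuclideanSpace ℝ (Fin d)) => fderiv ℝ S w.2.1 (w.2.2, (1:ℝ))) L
        (nhds (fderiv ℝ S p0 (z0, 1))) :=
      (isBoundedBilinearMap_apply.continuous.tendsto (fderiv ℝ S p0, (z0, (1:ℝ)))).comp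
        ((hfd.tendsto.comp hp).prodMk_nhds hz)
    have hlo := hst.isLittleO.comp_tendsto (hq.prodMk_nhds hp)
    have hbig : (fun w : ℝ × ((EuclideanSpace ℝ (Fin d) × ℝ) × EuclideanSpace ℝ (Fin d)) => w.1 • (w.2.2, (1:ℝ))) =O[L] fun w => w.1 := by
      simpa using (Asymptotics.isBigO_refl (fun w : ℝ × ((EuclideanSpace ℝ (Fin d) × ℝ) × EuclideanSpace ℝ (Fin d)) => w.1) L).smul (hz.isBigO_one ℝ)
    have hlo2 := (hlo.trans_isBigO (by simpa [Function.comp_def] using hbig)).tendsto_div_nhds_zero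
    have hS1 : Filter.Tendsto (fun w : ℝ × ((EuclideanSpace ℝ (Fin d) × ℝ) × EuclideanSpace ℝ (Fin d)) =>
        w.1⁻¹ * (S (w.2.1 + w.1 • (w.2.2, (1:ℝ))) - S w.2.1)) L (nhds (fderiv ℝ S p0 (z0, 1))) := by
      have h2 := hlo2.add (((fderiv ℝ S p0).continuous.tendsto _).comp hz)
      rw [zero_add] at h2
      refine h2.congr' ?_
      filter_upwards [hpos] with w hw
      simp only [Function.comp_def, add_sub_cancel_left, map_smul, smul_eq_mul]
      field_simp
      ring
    have hK0 : K p0 ≠ 0 := (hKpos p0 hp0).ne'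
    have hR : Filter.Tendsto (fun w : ℝ × ((EuclideanSpace ℝ (Fin d) × ℝ) × EuclideanSpace ℝ (Fin d)) =>
        pe w.1 (w.2.1 + w.1 • (w.2.2, (1:ℝ))) / pe w.1 w.2.1 -
          Real.exp (-(fderiv ℝ S w.2.1 (w.2.2, 1)))) L (nhds 0) := by
      have h3 := (((hK _ hq).div (hK _ hp) hK0).mul
        ((Real.continuous_exp.tendsto _).comp hS1.neg)).sub
        ((Real.continuous_exp.tendsto _).comp hlim.neg)
      rw [div_self hK0, one_mul, sub_self] at h3
      refine h3.congr fun w => ?_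
      simp only [Function.comp_def, hpe, Pi.div_apply]
      rw [mul_div_mul_comm, ← Real.exp_sub]
      congr 3
      ring_nf
    have h4 := hR.abs
    rw [abs_zero] at h4
    filter_upwards [hq.eventually hDn, h4.eventually (gt_mem_nhds hη)] with w h5 h6
    exact ⟨h5, h6⟩
  have hev := (hΓ.prod hF).eventually_forall_of_forall_eventually
    (P := fun (e : ℝ) (y : (EuclideanSpace ℝ (Fin d) × ℝ) × EuclideanSpace ℝ (Fin d)) =>
      0 < e → (y.1 + e • (y.2, (1:ℝ)) ∈ D ∧
        |pe e (y.1 + e • (y.2, (1:ℝ))) / pe e y.1 -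
          Real.exp (-(fderiv ℝ S y.1 (y.2, 1)))| < η)) key
  obtain ⟨δ, hδ, hball⟩ := Metric.eventually_nhds_iff.1 hev
  refine ⟨min δ ε₀, lt_min hδ hε₀, min_le_right _ _, fun ε h0 h1 x t hx z hz => ?_⟩
  have h := hball (y := ε) (by
    rw [Real.dist_eq, sub_zero, abs_of_pos h0]; exact h1.trans_le (min_le_left _ _))
    ((x, t), z) ⟨hx, hz⟩ h0
  have e1 : ((x, t) : EuclideanSpace ℝ (Fin d) × ℝ) + ε • (z, (1:ℝ)) = (x + ε • z, t + ε) := by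
    simp
  have e2 : -(fderiv ℝ S (x, t) (z, 0)) - fderiv ℝ S (x, t) (0, 1)
      = -(fderiv ℝ S (x, t) (z, 1)) := by
    have : ((z, 1) : EuclideanSpace ℝ (Fin d) × ℝ) = (z, 0) + (0, 1) := by simp
    rw [this, map_add]; ring
  rw [e2, ← e1]
  exact h
end

section
/- Let ψ : ℝ → [0,∞) be even and nonincreasing on [0,∞), and define φ'(v) = ∫_0^v ψ(w) dw and φ(u) = ∫_0^u φ'(v) dv. Then for all u, z ∈ ℝ: φ(u + z) − φ(z) − u·φ'(z) ≤ 4·φ(u/2). -/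
open MeasureTheory intervalIntegral

/-- Let `ψ : ℝ → [0,∞)` be even and nonincreasing on `[0,∞)`, and define
`φ'(v) = ∫_0^v ψ(w) dw` and `φ(u) = ∫_0^u φ'(v) dv`. Then for all `u, z ∈ ℝ`,
`φ(u + z) - φ(z) - u·φ'(z) ≤ 4·φ(u/2)`. -/
theorem convexity_increment_bound
    (ψ : ℝ → ℝ) (hψnonneg : ∀ w, 0 ≤ ψ w)
    (hψeven : ∀ w, ψ (-w) = ψ w)
    (hψanti : AntitoneOn ψ (Set.Ici 0))
    (φ' : ℝ → ℝ) (hφ' : ∀ v, φ' v = ∫ w in (0 : ℝ)..v, ψ w)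
    (φ : ℝ → ℝ) (hφ : ∀ u, φ u = ∫ v in (0 : ℝ)..u, φ' v) :
    ∀ u z : ℝ, φ (u + z) - φ z - u * φ' z ≤ 4 * φ (u / 2) := by
  have habs : ∀ x, ψ x = ψ |x| := by
    intro x
    rcases abs_choice x with h | h <;> rw [h]
    rw [hψeven]
  have hcmp : ∀ x y : ℝ, |x| ≤ |y| → ψ y ≤ ψ x := by
    intro x y h
    rw [habs x, habs y]
    exact hψanti (abs_nonneg x) (abs_nonneg y) h
  have hint0 : ∀ a : ℝ, 0 ≤ a → IntervalIntegrable ψ volume 0 a := by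
    intro a ha
    apply AntitoneOn.intervalIntegrable
    apply hψanti.mono
    rw [Set.uIcc_of_le ha]
    exact fun x hx => hx.1
  have hint1 : ∀ a : ℝ, IntervalIntegrable ψ volume 0 a := by
    intro a
    rcases le_total 0 a with ha | ha
    · exact hint0 a ha
    · apply MonotoneOn.intervalIntegrable
      rw [Set.uIcc_of_ge ha]
      intro x hx y hy hxy
      apply hcmp
      rw [abs_of_nonpos hx.2, abs_of_nonpos hy.2]
      linarith
  have hint : ∀ a b : ℝ, IntervalIntegrable ψ volume a b :=
    fun a b => (hint1 a).symm.trans (hint1 b)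
  have hcont : Continuous φ' := by
    have : φ' = fun v => ∫ w in (0 : ℝ)..v, ψ w := funext hφ'
    rw [this]
    exact intervalIntegral.continuous_primitive hint 0
  have hodd : ∀ v, φ' (-v) = - φ' v := by
    intro v
    have h := intervalIntegral.integral_comp_neg (a := 0) (b := v) ψ
    simp only [hψeven, neg_zero] at h
    rw [hφ', hφ', h, ← intervalIntegral.integral_symm]
  have heven : ∀ v, φ (-v) = φ v := by
    intro v
    have h := intervalIntegral.integral_comp_neg (a := 0) (b := v) φ'
    simp only [hodd, neg_zero, intervalIntegral.integral_neg] at h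
    rw [hφ, hφ, intervalIntegral.integral_symm, ← h, neg_neg]
  have hshift : ∀ m c : ℝ, φ' (m + c) - φ' c = ∫ s in (0:ℝ)..m, ψ (s + c) := by
    intro m c
    rw [intervalIntegral.integral_comp_add_right (fun x => ψ x), hφ', hφ', zero_add,
      intervalIntegral.integral_interval_sub_left (hint _ _) (hint _ _)]
  have hshint : ∀ m c : ℝ, IntervalIntegrable (fun s => ψ (s + c)) volume 0 m := by
    intro m c
    simpa using (hint (0 + c) (m + c)).comp_add_right c
  have key0 : ∀ m h : ℝ, 0 ≤ m → 0 ≤ h → φ' (m + h) - φ' (m - h) ≤ 2 * φ' h := by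
    intro m h hm hh
    have h1 : φ' (m + h) - φ' h ≤ φ' (m + -h) - φ' (-h) := by
      rw [hshift, hshift]
      apply intervalIntegral.integral_mono_on hm (hshint _ _) (hshint _ _)
      intro s hs
      apply hcmp
      have := hs.1
      rw [abs_of_nonneg (by linarith : 0 ≤ s + h), abs_le]
      constructor <;> linarith
    rw [hodd, ← sub_eq_add_neg] at h1
    linarith
  have key : ∀ m h : ℝ, 0 ≤ h → φ' (m + h) - φ' (m - h) ≤ 2 * φ' h := by
    intro m h hh
    rcases le_total 0 m with hm | hm
    · exact key0 m h hm hh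
    · have h1 := key0 (-m) h (by linarith) hh
      rw [show -m + h = -(m - h) by ring, show -m - h = -(m + h) by ring, hodd, hodd] at h1
      linarith
  have main : ∀ u z : ℝ, 0 ≤ u → φ (u + z) - φ z - u * φ' z ≤ 4 * φ (u / 2) := by
    intro u z hu
    have e1 : φ (u + z) - φ z - u * φ' z = ∫ v in (0:ℝ)..u, (φ' (v + z) - φ' z) := by
      rw [intervalIntegral.integral_sub
        (f := fun v => φ' (v + z)) (g := fun _ => φ' z)
        (Continuous.intervalIntegrable (by fun_prop) _ _)
        (Continuous.intervalIntegrable (by fun_prop) _ _),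
        intervalIntegral.integral_comp_add_right (fun x => φ' x), hφ, hφ, zero_add,
        intervalIntegral.integral_interval_sub_left (hcont.intervalIntegrable _ _)
          (hcont.intervalIntegrable _ _)]
      simp
    have e2 : 4 * φ (u / 2) = ∫ v in (0:ℝ)..u, 2 * φ' (v / 2) := by
      rw [intervalIntegral.integral_const_mul,
        intervalIntegral.integral_comp_div (fun x => φ' x) two_ne_zero, hφ]
      simp
      ring
    rw [e1, e2]
    apply intervalIntegral.integral_mono_on hu
    · exact Continuous.intervalIntegrable (by fun_prop) _ _
    · exact Continuous.intervalIntegrable (by fun_prop) _ _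
    · intro v hv
      have := key (z + v / 2) (v / 2) (by linarith [hv.1])
      rw [show z + v / 2 + v / 2 = v + z by ring, show z + v / 2 - v / 2 = z by ring] at this
      exact this
  intro u z
  rcases le_total 0 u with hu | hu
  · exact main u z hu
  · have h := main (-u) (-z) (by linarith)
    rw [show -u + -z = -(u + z) by ring, show -u / 2 = -(u / 2) by ring, heven, heven, heven,
      hodd] at h
    linarith
end

section
/- Let ψ : ℝ → [0,∞) be even and nonincreasing on [0,∞), with φ'(v) = ∫_0^v ψ(w) dw and φ(u) = ∫_0^u φ'(v) dv. Let (Ω, F, P) be a probability space with a filtration (F_m)_{0 ≤ m ≤ N}, and let (ξ_m)_{0 ≤ m ≤ N} be a real-valued martingale with respect to (F_m) with ξ_0 = 0, such that for each m the random variables φ(ξ_m), φ'(ξ_m), (ξ_{m+1} − ξ_m)·φ'(ξ_m) and φ((ξ_{m+1} − ξ_m)/2) are integrable. Then E[φ(ξ_N)] ≤ 4 · Σ_{i=0}^{N−1} E[φ((ξ_{i+1} − ξ_i)/2)]. -/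
open MeasureTheory

theorem psi_ii (ψ : ℝ → ℝ) (hn : ∀ w, 0 ≤ ψ w) (he : ∀ w, ψ (-w) = ψ w)
    (ha : AntitoneOn ψ (Set.Ici 0)) (a b : ℝ) : IntervalIntegrable ψ volume a b := by
  have habs : ∀ w, ψ w = ψ |w| := by
    intro w
    rcases abs_choice w with h | h <;> rw [h]
    rw [he]
  have hg : Antitone (fun x : ℝ => ψ (max x 0)) := by
    intro x y hxy
    exact ha (by simp) (by simp) (max_le_max_right 0 hxy)
  have hm : Measurable ψ := by
    have h1 : Measurable (fun x : ℝ => ψ (max |x| 0)) := hg.measurable.comp measurable_abs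
    have h2 : ψ = (fun x : ℝ => ψ (max |x| 0)) := by
      funext x
      rw [max_eq_left (abs_nonneg x)]
      exact habs x
    rw [h2]; exact h1
  refine (intervalIntegrable_const (c := ψ 0)).mono_fun hm.aestronglyMeasurable ?_
  refine Filter.Eventually.of_forall fun x => ?_
  simp only [Real.norm_eq_abs, abs_of_nonneg (hn _)]
  rw [habs x]
  exact ha (by simp) (by simp) (abs_nonneg x)

theorem phi_key (ψ : ℝ → ℝ) (hn : ∀ w, 0 ≤ ψ w) (he : ∀ w, ψ (-w) = ψ w)
    (ha : AntitoneOn ψ (Set.Ici 0)) (φ' : ℝ → ℝ) (hφ' : ∀ v, φ' v = ∫ w in (0 : ℝ)..v, ψ w)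
    (hodd : ∀ v, φ' (-v) = - φ' v) (c h : ℝ) (hc : 0 ≤ c) (hh : 0 ≤ h) :
    φ' (c + h) - φ' (c - h) ≤ 2 * φ' h := by
  have ii := psi_ii ψ hn he ha
  have hsub : ∀ a b, φ' b - φ' a = ∫ w in a..b, ψ w := by
    intro a b
    rw [hφ', hφ', intervalIntegral.integral_interval_sub_left (ii _ _) (ii _ _)]
  have h1 := hsub h (c + h)
  have h2 := hsub (-h) (c - h)
  have h3 : ∫ w in h..(c+h), ψ (w - 2 * h) = ∫ w in (-h)..(c-h), ψ w := by
    rw [intervalIntegral.integral_comp_sub_right]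
    congr 1 <;> ring
  have h4 : ∫ w in h..(c+h), ψ w ≤ ∫ w in h..(c+h), ψ (w - 2 * h) := by
    refine intervalIntegral.integral_mono_on (by linarith) (ii _ _) ?_ ?_
    · have := (ii (h - 2*h) (c + h - 2*h)).comp_sub_right (2*h)
      simpa using this
    · intro x hx
      have hx1 := hx.1
      rcases abs_choice (x - 2*h) with e | e
      · have h0 := abs_nonneg (x-2*h)
        rw [e] at h0
        exact ha h0 (by simp; linarith) (by linarith)
      · have h0 := abs_nonneg (x-2*h)
        rw [e] at h0
        rw [← he (x - 2*h)]
        exact ha h0 (by simp; linarith) (by linarith)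
  rw [hodd] at h2
  linarith

theorem phi_bound (ψ : ℝ → ℝ) (hn : ∀ w, 0 ≤ ψ w) (he : ∀ w, ψ (-w) = ψ w)
    (ha : AntitoneOn ψ (Set.Ici 0)) (φ' : ℝ → ℝ) (hφ' : ∀ v, φ' v = ∫ w in (0 : ℝ)..v, ψ w)
    (φ : ℝ → ℝ) (hφ : ∀ u, φ u = ∫ v in (0 : ℝ)..u, φ' v) (hcont : Continuous φ') (u z : ℝ) :
    φ (u + z) - φ z - u * φ' z ≤ 4 * φ (u / 2) := by
  have hodd : ∀ v, φ' (-v) = - φ' v := by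
    intro v
    rw [hφ', hφ']
    have := intervalIntegral.integral_comp_neg (a := 0) (b := v) ψ
    simp only [he, neg_zero] at this
    rw [this, ← intervalIntegral.integral_symm]
  have heven : ∀ v, φ (-v) = φ v := by
    intro v
    rw [hφ, hφ]
    have := intervalIntegral.integral_comp_neg (a := 0) (b := v) φ'
    simp only [hodd, neg_zero, intervalIntegral.integral_neg] at this
    rw [intervalIntegral.integral_symm, ← this, neg_neg]
  have key : ∀ c h, 0 ≤ h → φ' (c + h) - φ' (c - h) ≤ 2 * φ' h := by
    intro c h hh
    rcases le_total 0 c with hc | hc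
    · exact phi_key ψ hn he ha φ' hφ' hodd c h hc hh
    · have := phi_key ψ hn he ha φ' hφ' hodd (-c) h (by linarith) hh
      rw [show -c + h = -(c - h) by ring, show -c - h = -(c + h) by ring, hodd, hodd] at this
      linarith
  have pos : ∀ u z, 0 ≤ u → φ (u + z) - φ z - u * φ' z ≤ 4 * φ (u / 2) := by
    intro u z hu
    have e1 : φ (u + z) - φ z - u * φ' z = ∫ v in (0:ℝ)..u, (φ' (v + z) - φ' z) := by
      rw [intervalIntegral.integral_sub
        (Continuous.intervalIntegrable (by fun_prop) _ _) (by simp),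
        intervalIntegral.integral_comp_add_right, hφ, hφ,
        intervalIntegral.integral_interval_sub_left (hcont.intervalIntegrable _ _)
          (hcont.intervalIntegrable _ _)]
      simp
    have e2 : 4 * φ (u / 2) = ∫ v in (0:ℝ)..u, 2 * φ' (v / 2) := by
      rw [intervalIntegral.integral_const_mul,
        intervalIntegral.integral_comp_div _ (by norm_num : (2:ℝ) ≠ 0), hφ]
      simp only [smul_eq_mul, zero_div]
      ring
    rw [e1, e2]
    refine intervalIntegral.integral_mono_on hu
      (Continuous.intervalIntegrable (by fun_prop) _ _)
      (Continuous.intervalIntegrable (by fun_prop) _ _) ?_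
    intro v hv
    have := key (z + v / 2) (v / 2) (by linarith [hv.1])
    rw [show z + v / 2 + v / 2 = v + z by ring, show z + v / 2 - v / 2 = z by ring] at this
    exact this
  rcases le_total 0 u with hu | hu
  · exact pos u z hu
  · have := pos (-u) (-z) (by linarith)
    rw [show -u + -z = -(u + z) by ring, show -u / 2 = -(u / 2) by ring, heven, heven, heven,
      hodd] at this
    linarith


/-- **martingale moment inequality.** Let `ψ : ℝ → [0,∞)` be even and
nonincreasing on `[0,∞)`, with `φ'(v) = ∫_0^v ψ(w) dw` and `φ(u) = ∫_0^u φ'(v) dv`.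
Let `(ξ_m)_{0 ≤ m ≤ N}` be a real-valued martingale with `ξ₀ = 0` such that, for each
`m`, `φ(ξ_m)`, `φ'(ξ_m)`, `(ξ_{m+1} - ξ_m)·φ'(ξ_m)` and `φ((ξ_{m+1} - ξ_m)/2)` are
integrable. Then `E[φ(ξ_N)] ≤ 4·Σ_{i=0}^{N-1} E[φ((ξ_{i+1} - ξ_i)/2)]`. -/
theorem martingale_phi_moment_bound
    (ψ : ℝ → ℝ) (hψnonneg : ∀ w, 0 ≤ ψ w)
    (hψeven : ∀ w, ψ (-w) = ψ w)
    (hψanti : AntitoneOn ψ (Set.Ici 0))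
    (φ' : ℝ → ℝ) (hφ' : ∀ v, φ' v = ∫ w in (0 : ℝ)..v, ψ w)
    (φ : ℝ → ℝ) (hφ : ∀ u, φ u = ∫ v in (0 : ℝ)..u, φ' v)
    {Ω : Type*} {m0 : MeasurableSpace Ω} (μ : Measure Ω) [IsProbabilityMeasure μ]
    (ℱ : Filtration ℕ m0) (N : ℕ)
    (ξ : ℕ → Ω → ℝ) (hmart : Martingale ξ ℱ μ)
    (hξ0 : ∀ᵐ ω ∂μ, ξ 0 ω = 0)
    (hφint : ∀ m ≤ N, Integrable (fun ω => φ (ξ m ω)) μ)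
    (hφ'int : ∀ m ≤ N, Integrable (fun ω => φ' (ξ m ω)) μ)
    (hcrossint : ∀ m < N, Integrable (fun ω => (ξ (m + 1) ω - ξ m ω) * φ' (ξ m ω)) μ)
    (hincint : ∀ m < N, Integrable (fun ω => φ ((ξ (m + 1) ω - ξ m ω) / 2)) μ) :
    (∫ ω, φ (ξ N ω) ∂μ) ≤
      4 * ∑ i ∈ Finset.range N, ∫ ω, φ ((ξ (i + 1) ω - ξ i ω) / 2) ∂μ := by
  have hcont : Continuous φ' := by
    have : φ' = fun v => ∫ w in (0 : ℝ)..v, ψ w := funext hφ'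
    rw [this]
    exact intervalIntegral.continuous_primitive (psi_ii ψ hψnonneg hψeven hψanti) 0
  have cross : ∀ m < N, ∫ ω, (ξ (m + 1) ω - ξ m ω) * φ' (ξ m ω) ∂μ = 0 := by
    intro m hm
    have hsm : StronglyMeasurable[ℱ m] (fun ω => φ' (ξ m ω)) :=
      hcont.comp_stronglyMeasurable (hmart.stronglyMeasurable m)
    have hint := (hmart.integrable (m + 1)).sub (hmart.integrable m)
    have h1 := condExp_mul_of_stronglyMeasurable_right (μ := μ) hsm (f := ξ (m + 1) - ξ m)
      (hcrossint m hm) hint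
    have h2 : μ[ξ (m + 1) - ξ m | ℱ m] =ᵐ[μ] 0 := by
      filter_upwards [condExp_sub (hmart.integrable (m + 1)) (hmart.integrable m) (ℱ m),
        hmart.condExp_ae_eq (Nat.le_succ m), hmart.condExp_ae_eq (le_refl m)] with ω a b c
      rw [a, Pi.sub_apply, b, c]; simp
    have h3 := integral_condExp (μ := μ) (f := (ξ (m + 1) - ξ m) * (fun ω => φ' (ξ m ω))) (ℱ.le m)
    have h4 : ∫ ω, (μ[(ξ (m + 1) - ξ m) * (fun ω => φ' (ξ m ω)) | ℱ m]) ω ∂μ = 0 := by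
      apply integral_eq_zero_of_ae
      filter_upwards [h1, h2] with ω a b
      rw [a, Pi.mul_apply, b]; simp
    rw [h4] at h3
    exact h3.symm
  have main : ∀ n ≤ N, (∫ ω, φ (ξ n ω) ∂μ) ≤
      4 * ∑ i ∈ Finset.range n, ∫ ω, φ ((ξ (i + 1) ω - ξ i ω) / 2) ∂μ := by
    intro n
    induction n with
    | zero =>
      intro _
      have : (∫ ω, φ (ξ 0 ω) ∂μ) = 0 := by
        apply integral_eq_zero_of_ae
        filter_upwards [hξ0] with ω h
        simp [h, hφ]
      simp [this]
    | succ n ih =>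
      intro hn
      have hI := ih (by omega)
      have hn' : n < N := hn
      have step : (∫ ω, φ (ξ (n + 1) ω) ∂μ) ≤ ∫ ω, (φ (ξ n ω) +
          (ξ (n + 1) ω - ξ n ω) * φ' (ξ n ω) + 4 * φ ((ξ (n + 1) ω - ξ n ω) / 2)) ∂μ := by
        refine integral_mono (hφint _ hn)
          (((hφint n hn'.le).add (hcrossint n hn')).add ((hincint n hn').const_mul 4)) ?_
        intro ω
        have := phi_bound ψ hψnonneg hψeven hψanti φ' hφ' φ hφ hcont
          (ξ (n + 1) ω - ξ n ω) (ξ n ω)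
        rw [sub_add_cancel] at this
        simp only
        linarith
      have hA : Integrable (fun ω => φ (ξ n ω) + (ξ (n + 1) ω - ξ n ω) * φ' (ξ n ω)) μ :=
        (hφint n hn'.le).add (hcrossint n hn')
      rw [integral_add hA ((hincint n hn').const_mul 4),
        integral_add (hφint n hn'.le) (hcrossint n hn'), cross n hn', integral_const_mul] at step
      rw [Finset.sum_range_succ]
      linarith
  exact main N le_rfl
end

section
/- Let a₀, a₁ ∈ ℝ with a₁ ≠ 0, let T > 0 and x₀, x_T ∈ ℝ, and define φ*(t) = x₀·sinh(a₁(T−t))/sinh(a₁T) + x_T·sinh(a₁t)/sinh(a₁T) − (a₀/a₁)·(1 − sinh(a₁(T−t))/sinh(a₁T) − sinh(a₁t)/sinh(a₁T)) for t ∈ [0,T]. Then φ*(0) = x₀, φ*(T) = x_T, φ* is continuously differentiable, and for every absolutely continuous ψ : [0,T] → ℝ with derivative ψ', ψ(0) = x₀, ψ(T) = x_T, and t ↦ (ψ'(t) − a₀ − a₁ψ(t))² integrable, one has ∫_0^T (φ*'(t) − a₀ − a₁ φ*(t))² dt ≤ ∫_0^T (ψ'(t) − a₀ − a₁ ψ(t))²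 dt; i.e., φ* minimizes the quadratic action with affine drift among absolutely continuous paths with the given endpoints. -/
open MeasureTheory Real

theorem ou_aux (a T : ℝ) (h' : ℝ → ℝ) (hi : IntervalIntegrable h' volume 0 T)
    (h0 : ∫ s in (0 : ℝ)..T, h' s = 0) :
    ∫ t in (0 : ℝ)..T, Real.exp (-a * t) * (h' t - a * ∫ s in (0 : ℝ)..t, h' s) = 0 := by
  have hG := hi.absolutelyContinuousOnInterval_intervalIntegral (c := 0) (by simp)
  have hd : ∀ t : ℝ, HasDerivAt (fun t => Real.exp (-a * t)) (Real.exp (-a * t) * (-a)) t := by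
    intro t
    simpa using ((hasDerivAt_id t).const_mul (-a)).exp
  have hE : AbsolutelyContinuousOnInterval (fun t => Real.exp (-a * t)) 0 T := by
    apply ContDiffOn.absolutelyContinuousOnInterval
    fun_prop
  have key := hE.integral_deriv_mul_eq_sub hG
  simp only [h0, intervalIntegral.integral_same, mul_zero, sub_zero] at key
  refine Eq.trans ?_ key
  apply intervalIntegral.integral_congr_ae
  filter_upwards [hi.ae_hasDerivAt_integral] with x hx hxm
  rw [(hd x).deriv, (hx (Set.uIoc_subset_uIcc hxm) 0 (by simp)).deriv]
  ring

/-- **optimal path for the Ornstein–Uhlenbeck action.** Let `a₁ ≠ 0`,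
`T > 0`, and define
`φ*(t) = x₀·sinh(a₁(T-t))/sinh(a₁T) + x_T·sinh(a₁t)/sinh(a₁T)
          - (a₀/a₁)·(1 - sinh(a₁(T-t))/sinh(a₁T) - sinh(a₁t)/sinh(a₁T))`.
Then `φ*(0) = x₀`, `φ*(T) = x_T`, `φ*` is continuously differentiable, and for every
absolutely continuous path `ψ` with derivative `ψ'` joining `x₀` to `x_T` in time `T`
with integrable quadratic action integrand,
`∫_0^T (φ*'(t) - a₀ - a₁φ*(t))² dt ≤ ∫_0^T (ψ'(t) - a₀ - a₁ψ(t))² dt`;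
i.e. `φ*` minimizes the quadratic action with affine drift. -/
theorem ou_bridge_minimizes_quadratic_action
    (a₀ a₁ : ℝ) (ha₁ : a₁ ≠ 0) (T : ℝ) (hT : 0 < T) (x₀ xT : ℝ)
    (φstar : ℝ → ℝ)
    (hφstar : ∀ t, φstar t =
      x₀ * Real.sinh (a₁ * (T - t)) / Real.sinh (a₁ * T) +
      xT * Real.sinh (a₁ * t) / Real.sinh (a₁ * T) -
      (a₀ / a₁) * (1 - Real.sinh (a₁ * (T - t)) / Real.sinh (a₁ * T) -
        Real.sinh (a₁ * t) / Real.sinh (a₁ * T))) :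
    φstar 0 = x₀ ∧ φstar T = xT ∧ ContDiff ℝ 1 φstar ∧
    ∀ ψ ψ' : ℝ → ℝ,
      IntegrableOn ψ' (Set.Icc 0 T) volume →
      (∀ t ∈ Set.Icc (0 : ℝ) T, ψ t = ψ 0 + ∫ s in (0 : ℝ)..t, ψ' s) →
      ψ 0 = x₀ → ψ T = xT →
      IntegrableOn (fun t => (ψ' t - a₀ - a₁ * ψ t) ^ 2) (Set.Icc 0 T) volume →
      (∫ t in (0 : ℝ)..T, (deriv φstar t - a₀ - a₁ * φstar t) ^ 2) ≤
        ∫ t in (0 : ℝ)..T, (ψ' t - a₀ - a₁ * ψ t) ^ 2 := by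
  have hS : Real.sinh (a₁ * T) ≠ 0 := by
    rw [Ne, Real.sinh_eq_zero]
    exact mul_ne_zero ha₁ hT.ne'
  have e0 : φstar 0 = x₀ := by
    rw [hφstar]; simp; field_simp; ring
  have eT : φstar T = xT := by
    rw [hφstar]; simp; field_simp; ring
  have hC : ContDiff ℝ 1 φstar := by
    rw [funext hφstar]
    have : ContDiff ℝ 1 (fun t : ℝ => Real.sinh (a₁ * (T - t))) :=
      Real.contDiff_sinh.comp (by fun_prop)
    have : ContDiff ℝ 1 (fun t : ℝ => Real.sinh (a₁ * t)) :=
      Real.contDiff_sinh.comp (by fun_prop)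
    fun_prop
  refine ⟨e0, eT, hC, ?_⟩
  intro ψ ψ' hψ' hψ hψ0 hψT hint
  obtain ⟨C, hp⟩ : ∃ C : ℝ, ∀ t, deriv φstar t - a₀ - a₁ * φstar t = C * Real.exp (-a₁ * t) := by
    refine ⟨a₁ / Real.sinh (a₁ * T) *
      ((xT + a₀ / a₁) - (x₀ + a₀ / a₁) * Real.exp (a₁ * T)), fun t => ?_⟩
    have d1 : HasDerivAt (fun t : ℝ => Real.sinh (a₁ * (T - t)))
        (Real.cosh (a₁ * (T - t)) * (a₁ * (-1))) t :=
      (((hasDerivAt_id t).const_sub T).const_mul a₁).sinh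
    have d2 : HasDerivAt (fun t : ℝ => Real.sinh (a₁ * t))
        (Real.cosh (a₁ * t) * (a₁ * 1)) t :=
      ((hasDerivAt_id t).const_mul a₁).sinh
    have d := (((d1.const_mul x₀).div_const (Real.sinh (a₁ * T))).add
      ((d2.const_mul xT).div_const (Real.sinh (a₁ * T)))).sub
      ((((d1.div_const (Real.sinh (a₁ * T))).const_sub 1).sub
        (d2.div_const (Real.sinh (a₁ * T)))).const_mul (a₀ / a₁))
    have d' := d.congr_of_eventuallyEq (f₁ := φstar)
      (Filter.Eventually.of_forall fun s => hφstar s)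
    rw [d'.deriv, hφstar]
    have i1 : Real.exp (a₁ * T) * Real.exp (-a₁ * t)
        = Real.cosh (a₁ * (T - t)) + Real.sinh (a₁ * (T - t)) := by
      rw [Real.cosh_add_sinh, ← Real.exp_add]; ring_nf
    have i2 : Real.exp (-a₁ * t) = Real.cosh (a₁ * t) - Real.sinh (a₁ * t) := by
      rw [Real.cosh_sub_sinh]; ring_nf
    have i3 : a₁ / Real.sinh (a₁ * T) *
      ((xT + a₀ / a₁) - (x₀ + a₀ / a₁) * Real.exp (a₁ * T)) * Real.exp (-a₁ * t)
      = a₁ / Real.sinh (a₁ * T) * ((xT + a₀ / a₁) * Real.exp (-a₁ * t)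
        - (x₀ + a₀ / a₁) * (Real.exp (a₁ * T) * Real.exp (-a₁ * t))) := by ring
    rw [i3, i1, i2]
    field_simp
    ring
  have hψi : IntervalIntegrable ψ' volume 0 T :=
    (intervalIntegrable_iff_integrableOn_Icc_of_le hT.le).2 hψ'
  have hqi : IntervalIntegrable (fun t => (ψ' t - a₀ - a₁ * ψ t) ^ 2) volume 0 T :=
    (intervalIntegrable_iff_integrableOn_Icc_of_le hT.le).2 hint
  have hdc : Continuous (deriv φstar) := hC.continuous_deriv le_rfl
  have hφc : Continuous φstar := hC.continuous
  have hφi : ∀ a b, IntervalIntegrable (deriv φstar) volume a b :=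
    fun a b => hdc.intervalIntegrable a b
  have hφF : ∀ t, ∫ s in (0 : ℝ)..t, deriv φstar s = φstar t - φstar 0 := fun t =>
    intervalIntegral.integral_deriv_eq_sub
      (fun x _ => (hC.differentiable one_ne_zero) x) (hφi 0 t)
  have hhi : IntervalIntegrable (fun t => ψ' t - deriv φstar t) volume 0 T :=
    hψi.sub (hφi 0 T)
  have hH : ∀ t ∈ Set.Icc (0 : ℝ) T,
      ∫ s in (0 : ℝ)..t, (ψ' s - deriv φstar s) = ψ t - φstar t := by
    intro t ht
    rw [intervalIntegral.integral_sub _ (hφi 0 t), hφF, hψ t ht, hψ0, e0]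
    · ring
    · apply hψi.mono_set
      rw [Set.uIcc_of_le ht.1, Set.uIcc_of_le hT.le]
      exact Set.Icc_subset_Icc le_rfl ht.2
  have hz := ou_aux a₁ T _ hhi (by rw [hH T ⟨hT.le, le_rfl⟩, hψT, eT, sub_self])
  have hGc := (hhi.absolutelyContinuousOnInterval_intervalIntegral (c := 0) (by simp)).continuousOn
  have hwi : IntervalIntegrable (fun t => Real.exp (-a₁ * t) * ((ψ' t - deriv φstar t)
      - a₁ * ∫ s in (0 : ℝ)..t, (ψ' s - deriv φstar s))) volume 0 T := by
    refine (hhi.sub (hGc.intervalIntegrable.const_mul a₁)).continuousOn_mul ?_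
    fun_prop
  have hpi : IntervalIntegrable (fun t => (deriv φstar t - a₀ - a₁ * φstar t) ^ 2) volume 0 T := by
    apply Continuous.intervalIntegrable
    fun_prop
  have hsum : ∫ t in (0 : ℝ)..T, ((deriv φstar t - a₀ - a₁ * φstar t) ^ 2 +
      2 * C * (Real.exp (-a₁ * t) * ((ψ' t - deriv φstar t)
      - a₁ * ∫ s in (0 : ℝ)..t, (ψ' s - deriv φstar s))))
      = ∫ t in (0 : ℝ)..T, (deriv φstar t - a₀ - a₁ * φstar t) ^ 2 := by
    rw [intervalIntegral.integral_add hpi (hwi.const_mul _), intervalIntegral.integral_const_mul,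
      hz, mul_zero, add_zero]
  rw [← hsum]
  apply intervalIntegral.integral_mono_on hT.le (hpi.add (hwi.const_mul _)) hqi
  intro t ht
  rw [hH t ht]
  have := hp t
  have e : 2 * C * (Real.exp (-a₁ * t) * ((ψ' t - deriv φstar t) - a₁ * (ψ t - φstar t)))
    = 2 * (deriv φstar t - a₀ - a₁ * φstar t) *
      ((ψ' t - deriv φstar t) - a₁ * (ψ t - φstar t)) := by rw [this]; ring
  rw [e]
  nlinarith [sq_nonneg ((ψ' t - deriv φstar t) - a₁ * (ψ t - φstar t))]
end
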